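/- arXiv:2312.08717 — 2 statements merged into one kernel-verified Lean document; each statement's English description precedes it below -/
import Mathlib

section
/- For all LTL_X formulas α, β, ψ, the set of traces satisfying the GX_0 formula α → (β ∧ □ψ) is a safety property: for every trace σ that does not satisfy α → (β ∧ □ψ), there exists n ∈ ℕ such that every trace τ agreeing with σ on positions 0, 1, ..., n also fails to satisfy α → (β ∧ □ψ). -/
/-- LTL_X formulas over atomic propositions `AP`: the only temporal operator
is the next operator `X` (`next`).  `ff` is the derived constant `false`. -/
inductive LTLX (AP : Type) : Type where
  | tt : LTLX AP
  | ff : LTLX AP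
  | atom : AP → LTLX AP
  | neg : LTLX AP → LTLX AP
  | or : LTLX AP → LTLX AP → LTLX AP
  | and : LTLX AP → LTLX AP → LTLX AP
  | next : LTLX AP → LTLX AP

variable {AP : Type}

/-- The suffix `σ^i` of a trace `σ`. -/
def shift (σ : ℕ → Set AP) (i : ℕ) : ℕ → Set AP := fun n => σ (n + i)

/-- Satisfaction of an LTL_X formula on an infinite trace `σ : ℕ → Set AP`. -/
def LTLX.sat (σ : ℕ → Set AP) : LTLX AP → Prop
  | .tt => True
  | .ff => False
  | .atom a => a ∈ σ 0
  | .neg φ => ¬ LTLX.sat σ φ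
  | .or φ ψ => LTLX.sat σ φ ∨ LTLX.sat σ ψ
  | .and φ ψ => LTLX.sat σ φ ∧ LTLX.sat σ ψ
  | .next φ => LTLX.sat (shift σ 1) φ

/-- Satisfaction of the GX₀ formula `α → (β ∧ □ψ)` on a trace `σ`,
where `σ ⊨ □ψ` iff `σ^i ⊨ ψ` for all `i ≥ 0`. -/
def satGX0 (σ : ℕ → Set AP) (α β ψ : LTLX AP) : Prop :=
  α.sat σ → (β.sat σ ∧ ∀ i : ℕ, ψ.sat (shift σ i))

/-- Satisfaction of an LTL_X formula depends only on a finite prefix. -/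
lemma LTLX.sat_depth (φ : LTLX AP) : ∃ n : ℕ, ∀ σ τ : ℕ → Set AP,
    (∀ k ≤ n, τ k = σ k) → (φ.sat τ ↔ φ.sat σ) := by
  induction φ with
  | tt => exact ⟨0, fun _ _ _ => Iff.rfl⟩
  | ff => exact ⟨0, fun _ _ _ => Iff.rfl⟩
  | atom a =>
    refine ⟨0, fun σ τ h => ?_⟩
    simp only [LTLX.sat, h 0 le_rfl]
  | neg φ ih =>
    obtain ⟨n, hn⟩ := ih
    exact ⟨n, fun σ τ h => not_congr (hn σ τ h)⟩
  | or φ ψ ih₁ ih₂ =>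
    obtain ⟨n, hn⟩ := ih₁
    obtain ⟨m, hm⟩ := ih₂
    exact ⟨n + m, fun σ τ h => or_congr (hn σ τ fun k hk => h k (by omega))
      (hm σ τ fun k hk => h k (by omega))⟩
  | and φ ψ ih₁ ih₂ =>
    obtain ⟨n, hn⟩ := ih₁
    obtain ⟨m, hm⟩ := ih₂
    exact ⟨n + m, fun σ τ h => and_congr (hn σ τ fun k hk => h k (by omega))
      (hm σ τ fun k hk => h k (by omega))⟩
  | next φ ih =>
    obtain ⟨n, hn⟩ := ih
    exact ⟨n + 1, fun σ τ h => hn (shift σ 1) (shift τ 1)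
      fun k hk => h (k + 1) (by omega)⟩

/-- for all LTL_X formulas `α β ψ`, the set of traces satisfying
`α → (β ∧ □ψ)` is a safety property: every trace violating it has a finite
bad prefix. -/
theorem gx0_is_safety (α β ψ : LTLX AP) (σ : ℕ → Set AP)
    (h : ¬ satGX0 σ α β ψ) :
    ∃ n : ℕ, ∀ τ : ℕ → Set AP, (∀ k ≤ n, τ k = σ k) → ¬ satGX0 τ α β ψ := by
  obtain ⟨a, ha⟩ := α.sat_depth
  obtain ⟨b, hb⟩ := β.sat_depth
  obtain ⟨c, hc⟩ := ψ.sat_depth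
  unfold satGX0 at h
  rw [Classical.not_imp, not_and_or, not_forall] at h
  obtain ⟨h₁, h₂ | ⟨i, h₂⟩⟩ := h
  · refine ⟨a + b, fun τ hτ hs => h₂ ?_⟩
    exact (hb σ τ fun k hk => hτ k (by omega)).1
      (hs ((ha σ τ fun k hk => hτ k (by omega)).2 h₁)).1
  · refine ⟨a + (c + i), fun τ hτ hs => h₂ ?_⟩
    exact (hc (shift σ i) (shift τ i) fun k hk => hτ (k + i) (by omega)).1
      ((hs ((ha σ τ fun k hk => hτ k (by omega)).2 h₁)).2 i)
end

section
/- Let done be an atomic proposition and J a finite nonempty set of atomic propositions (the jump variables), and let jump abbreviate the disjunction ⋁_{j ∈ J} j. Suppose a trace σ satisfies the three formulas □(done → X done), □(jump → X done), and □(¬jump → (¬done → X ¬done)), and suppose done ∉ σ(0). Then for every position i, done ∈ σ(i) if and only if there exists a position k < i such that some j ∈ J belongs to σ(k). In particular, ¬done holds at every position up to and including the position of the first jump, and done holds at every position strictly after it. -/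
variable {AP : Type}

/-- Implication, a derived Boolean connective. -/
def LTLX.imp (φ ψ : LTLX AP) : LTLX AP := .or (.neg φ) ψ

/-- Finite disjunction `⋁` of a list of formulas. -/
def bigOr (l : List (LTLX AP)) : LTLX AP := l.foldr .or .ff

/-- `σ ⊨ □φ`: every suffix of `σ` satisfies `φ`. -/
def AlwaysSat (σ : ℕ → Set AP) (φ : LTLX AP) : Prop :=
  ∀ i : ℕ, φ.sat (shift σ i)

/-- A finite disjunction of atoms holds iff one of them holds at position `0`. -/
theorem sat_bigOr_atoms (σ : ℕ → Set AP) (l : List AP) :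
    (bigOr (l.map LTLX.atom)).sat σ ↔ ∃ j ∈ l, j ∈ σ 0 := by
  induction l with
  | nil => simp [bigOr, LTLX.sat]
  | cons a l ih =>
    simp only [bigOr, List.map_cons, List.foldr_cons, LTLX.sat] at ih ⊢
    rw [ih]
    simp

/-- `done`/`jump` dynamics.  Let `done` be an atomic proposition,
`J` a finite nonempty set of atomic propositions (the jump variables) and
`jump = ⋁_{j ∈ J} j`.  If `σ` satisfies `□(done → X done)`,
`□(jump → X done)` and `□(¬jump → (¬done → X ¬done))`, and `done ∉ σ(0)`,
then for every position `i`, `done ∈ σ(i)` iff some jump variable occurs in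
`σ(k)` for some `k < i`. -/
theorem done_iff_past_jump
    (done : AP) (J : Finset AP) (hJ : J.Nonempty) (σ : ℕ → Set AP)
    (jump : LTLX AP) (hjump : jump = bigOr (J.toList.map LTLX.atom))
    (h₁ : AlwaysSat σ (LTLX.imp (.atom done) (.next (.atom done))))
    (h₂ : AlwaysSat σ (LTLX.imp jump (.next (.atom done))))
    (h₃ : AlwaysSat σ (LTLX.imp (.neg jump)
            (LTLX.imp (.neg (.atom done)) (.next (.neg (.atom done))))))
    (h₀ : done ∉ σ 0) :
    ∀ i : ℕ, done ∈ σ i ↔ ∃ k < i, ∃ j ∈ J, j ∈ σ k := by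
  have hj : ∀ i, jump.sat (shift σ i) ↔ ∃ j ∈ J, j ∈ σ i := by
    intro i
    rw [hjump, sat_bigOr_atoms]
    simp [shift]
  have e₁ : ∀ i, done ∈ σ i → done ∈ σ (i + 1) := by
    intro i h
    have := h₁ i
    simp only [LTLX.imp, LTLX.sat, shift, Nat.zero_add, Nat.add_comm 1 i] at this
    tauto
  have e₂ : ∀ i, (∃ j ∈ J, j ∈ σ i) → done ∈ σ (i + 1) := by
    intro i h
    have := h₂ i
    simp only [LTLX.imp, LTLX.sat, hj] at this
    simp only [shift, Nat.zero_add, Nat.add_comm 1 i] at this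
    exact this.resolve_left (not_not_intro h)
  have e₃ : ∀ i, ¬ (∃ j ∈ J, j ∈ σ i) → done ∉ σ i → done ∉ σ (i + 1) := by
    intro i h h'
    have := h₃ i
    simp only [LTLX.imp, LTLX.sat, hj] at this
    simp only [shift, Nat.zero_add, Nat.add_comm 1 i] at this
    exact (this.resolve_left (not_not_intro h)).resolve_left (not_not_intro h')
  intro i
  induction i with
  | zero => simp [h₀]
  | succ n ih =>
    constructor
    · intro h
      by_cases hn : ∃ j ∈ J, j ∈ σ n
      · exact ⟨n, Nat.lt_succ_self n, hn⟩
      · by_cases hd : done ∈ σ n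
        · obtain ⟨k, hk, hkj⟩ := ih.1 hd
          exact ⟨k, Nat.lt_succ_of_lt hk, hkj⟩
        · exact absurd h (e₃ n hn hd)
    · rintro ⟨k, hk, hkj⟩
      rcases Nat.lt_succ_iff_lt_or_eq.1 hk with hlt | rfl
      · exact e₁ n (ih.2 ⟨k, hlt, hkj⟩)
      · exact e₂ k hkj
end
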